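/- arXiv:2108.09787 — 7 statements merged into one kernel-verified Lean document; each statement's English description precedes it below -/
import Mathlib

section
/- Let A be a vector space over a field k of characteristic different from 2 and 3, equipped with a bilinear antisymmetric bracket [·,·] : A×A→A, and set J(x,y,z) = [[x,y],z] + [[y,z],x] + [[z,x],y]. Then the Malcev identity J(x,y,[x,z]) = [J(x,y,z),x] holds for all x,y,z ∈ A if and only if the identity [[x,z],[y,w]] = [[[x,y],z],w] + [[[y,z],w],x] + [[[z,w],x],y] + [[[w,x],y],z] holds for all x,y,z,w ∈ A. -/
def IsBilin (k : Type*) [Field k] {A B C : Type*}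
    [AddCommGroup A] [Module k A] [AddCommGroup B] [Module k B]
    [AddCommGroup C] [Module k C] (f : A → B → C) : Prop :=
  (∀ (x y : A) (z : B), f (x + y) z = f x z + f y z) ∧
  (∀ (c : k) (x : A) (z : B), f (c • x) z = c • f x z) ∧
  (∀ (x : A) (y z : B), f x (y + z) = f x y + f x z) ∧
  (∀ (c : k) (x : A) (z : B), f x (c • z) = c • f x z)

def jacF {A : Type*} [AddCommGroup A] (br : A → A → A) (x y z : A) : A :=
  br (br x y) z + br (br y z) x + br (br z x) y

def IsMalcevBracket (k : Type*) [Field k] {A : Type*} [AddCommGroup A] [Module k A]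
    (br : A → A → A) : Prop :=
  IsBilin k br ∧ (∀ x y : A, br x y = - br y x) ∧
  (∀ x y z : A, jacF br x y (br x z) = br (jacF br x y z) x)

/-- Polarization of the Malcev identity in its repeated variable, with all products written
left-nested where possible. -/
theorem malcev_polarized {A : Type*} [AddCommGroup A] (br : A → A → A)
    (hadd : ∀ x y z : A, br (x + y) z = br x z + br y z)
    (hadd' : ∀ x y z : A, br x (y + z) = br x y + br x z)
    (hneg : ∀ x y : A, br (-x) y = -br x y)
    (hanti : ∀ x y : A, br x y = -br y x)
    (hM : ∀ x y z : A, jacF br x y (br x z) = br (jacF br x y z) x) (x w y z : A) :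
    br (br x y) (br w z) - br (br (br w z) y) x + br (br (br w z) x) y +
      (br (br w y) (br x z) - br (br (br x z) y) w + br (br (br x z) w) y) =
    br (br (br x y) z) w + br (br (br y z) x) w + br (br (br z x) y) w +
      (br (br (br w y) z) x + br (br (br y z) w) x + br (br (br z w) y) x) := by
  have hflip : ∀ a b c d : A, br (br a (br b c)) d = -br (br (br b c) a) d := fun a b c d => by
    rw [hanti a, hneg]
  have h := hM (x + w) y z
  have hx := hM x y z
  have hw := hM w y z
  simp only [jacF, hadd, hadd', hflip] at h hx hw
  linear_combination (norm := abel) h - hx - hw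

theorem stmt0 {k : Type*} [Field k] (h2 : (2 : k) ≠ 0) (h3 : (3 : k) ≠ 0)
    {A : Type*} [AddCommGroup A] [Module k A]
    (br : A → A → A) (hbil : IsBilin k br)
    (hanti : ∀ x y : A, br x y = - br y x) :
    (∀ x y z : A, jacF br x y (br x z) = br (jacF br x y z) x) ↔
    (∀ x y z w : A, br (br x z) (br y w) =
      br (br (br x y) z) w + br (br (br y z) w) x +
      br (br (br z w) x) y + br (br (br w x) y) z) := by
  obtain ⟨hadd, hsmul, hadd', hsmul'⟩ := hbil
  have hneg : ∀ x y : A, br (-x) y = -br x y := fun x y => by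
    simpa using hsmul (-1) x y
  have hneg' : ∀ x y : A, br x (-y) = -br x y := fun x y => by
    simpa using hsmul' (-1) x y
  constructor
  · intro hM x y z w
    have hP := malcev_polarized br hadd hadd' hneg hanti hM
    have h₁ := hP x y z w
    have h₂ := hP x z w y
    have h₃ := hP w x y z
    simp only [hanti y x, hanti z x, hanti w x, hanti z y, hanti w y, hanti w z, hneg, hneg',
      hanti (br z w) (br x y), hanti (br y w) (br x z), hanti (br y z) (br x w)] at h₁ h₂ h₃ ⊢
    rw [← sub_eq_zero]
    refine (smul_eq_zero.mp ?_).resolve_left h2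
    rw [two_smul]
    linear_combination (norm := abel) h₁ - h₂ + h₃
  · intro hS x y z
    have h := hS x y z x
    have hxx : br x x = 0 := by
      refine (smul_eq_zero.mp ?_).resolve_left h2
      rw [two_smul]
      nth_rewrite 1 [hanti x x]
      exact neg_add_cancel _
    have hzero : ∀ y : A, br 0 y = 0 := fun y => by simpa using hsmul 0 0 y
    simp only [jacF, hadd, hanti y (br x z), hanti z x, hanti y x, hneg, hneg', hxx, hzero,
      hanti (br x z) (br x y)] at h ⊢
    linear_combination (norm := abel) h
end

section
/- Let M be a Malcev algebra over k, V a k-vector space, and ▷ : M×V→V a bilinear map. Define an antisymmetric bracket on the direct sum M⊕V by [(x,u),(y,v)] = ([x,y], x▷v − y▷u). Then M⊕V with this bracket is a Malcev algebra if and only if the left-module condition holds: [x,z]▷(y▷q) = [[x,y],z]▷q − x▷([y,z]▷q) + y▷(x▷(z▷q)) − z▷(y▷(x▷q)) for all x,y,z ∈ M and q ∈ V. -/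
/-- The defect of the Sagle identity `(xz)(yt) = ((xy)z)t + ((yz)t)x + ((zt)x)y + ((tx)y)z`. -/
def sagleDefect {A : Type*} [AddCommGroup A] (br : A → A → A) (x y z t : A) : A :=
  br (br x z) (br y t) - (br (br (br x y) z) t + br (br (br y z) t) x
    + br (br (br z t) x) y + br (br (br t x) y) z)

section

variable {k : Type*} [Field k]

section Bilin

variable {A B C : Type*} [AddCommGroup A] [Module k A] [AddCommGroup B] [Module k B]
  [AddCommGroup C] [Module k C] {f : A → B → C}

theorem IsBilin.add_left (hf : IsBilin k f) (x y : A) (z : B) :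
    f (x + y) z = f x z + f y z := hf.1 x y z

theorem IsBilin.add_right (hf : IsBilin k f) (x : A) (y z : B) :
    f x (y + z) = f x y + f x z := hf.2.2.1 x y z

theorem IsBilin.zero_left (hf : IsBilin k f) (z : B) : f 0 z = 0 := by
  simpa using hf.2.1 0 0 z

theorem IsBilin.zero_right (hf : IsBilin k f) (x : A) : f x 0 = 0 := by
  simpa using hf.2.2.2 0 x 0

theorem IsBilin.neg_left (hf : IsBilin k f) (x : A) (z : B) : f (-x) z = -f x z := by
  simpa using hf.2.1 (-1) x z

theorem IsBilin.neg_right (hf : IsBilin k f) (x : A) (z : B) : f x (-z) = -f x z := by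
  simpa using hf.2.2.2 (-1) x z

theorem IsBilin.sub_right (hf : IsBilin k f) (x : A) (y z : B) :
    f x (y - z) = f x y - f x z := by
  rw [sub_eq_add_neg, hf.add_right, hf.neg_right, sub_eq_add_neg]

end Bilin

variable {A : Type*} [AddCommGroup A] [Module k A] {br : A → A → A}

theorem sagleDefect_rotate (hb : IsBilin k br) (ha : ∀ x y, br x y = -br y x) (x y z t : A) :
    sagleDefect br y z t x = sagleDefect br x y z t := by
  have h : br (br y t) (br z x) = br (br x z) (br y t) := by
    rw [ha z x, hb.neg_right, ha (br y t), neg_neg]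
  unfold sagleDefect
  rw [h]
  abel

theorem self_eq_zero_of_antisymm (h2 : (2 : k) ≠ 0) (ha : ∀ x y, br x y = -br y x) (x : A) :
    br x x = 0 := by
  have h : (2 : k) • br x x = 0 := by
    rw [two_smul]
    nth_rw 1 [ha x x]
    exact neg_add_cancel _
  exact (smul_eq_zero.mp h).resolve_left h2

theorem sagleDefect_self (h2 : (2 : k) ≠ 0) (hb : IsBilin k br) (ha : ∀ x y, br x y = -br y x)
    (x y z : A) :
    sagleDefect br x y z x = jacF br x y (br x z) - br (jacF br x y z) x := by
  unfold sagleDefect jacF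
  rw [self_eq_zero_of_antisymm h2 ha x, hb.zero_left, hb.zero_left, ha y x, hb.neg_right,
    ha (br x z) (br x y), ha z x, ha y (br x z)]
  simp only [hb.add_left, hb.neg_left]
  abel

/-- The linearization of the Malcev identity in the repeated variable. -/
theorem sagleDefect_swap (hb : IsBilin k br) (h : ∀ x y z, sagleDefect br x y z x = 0)
    (x y z t : A) : sagleDefect br t y z x = -sagleDefect br x y z t := by
  have hxt := h (x + t) y z
  have hx := h x y z
  have ht := h t y z
  have key : sagleDefect br (x + t) y z (x + t) = sagleDefect br x y z x
      + sagleDefect br t y z t + sagleDefect br x y z t + sagleDefect br t y z x := by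
    unfold sagleDefect
    simp only [hb.add_left, hb.add_right]
    abel
  rw [hxt, hx, ht, zero_add, zero_add] at key
  exact eq_neg_of_add_eq_zero_right key.symm

/-- In characteristic not two, the Malcev identity is equivalent to the Sagle identity. -/
theorem malcev_iff_sagleDefect_eq_zero (h2 : (2 : k) ≠ 0) (hb : IsBilin k br)
    (ha : ∀ x y, br x y = -br y x) :
    (∀ x y z : A, jacF br x y (br x z) = br (jacF br x y z) x) ↔
      ∀ x y z t : A, sagleDefect br x y z t = 0 := by
  refine ⟨fun h x y z t => ?_, fun h x y z => ?_⟩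
  · have hs := sagleDefect_swap hb fun x y z => by
      rw [sagleDefect_self h2 hb ha, h, sub_self]
    have hr := sagleDefect_rotate hb ha
    -- A four-cycle is a product of three transpositions, hence changes the sign.
    have hneg : sagleDefect br x y z t = -sagleDefect br x y z t := by
      calc sagleDefect br x y z t = -sagleDefect br t y z x := hs t y z x
        _ = -sagleDefect br y z x t := by rw [hr t y z x]
        _ = sagleDefect br t z x y := by rw [hs t z x y]; simp
        _ = sagleDefect br z x y t := by rw [hr t z x y]
        _ = -sagleDefect br t x y z := hs t x y z
        _ = -sagleDefect br x y z t := by rw [hr t x y z]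
    have h0 : (2 : k) • sagleDefect br x y z t = 0 := by
      rw [two_smul]
      nth_rw 1 [hneg]
      exact neg_add_cancel _
    exact (smul_eq_zero.mp h0).resolve_left h2
  · rw [← sub_eq_zero, ← sagleDefect_self h2 hb ha, h]

end

section Semidirect

variable {k : Type*} [Field k] {M V : Type*} [AddCommGroup M] [Module k M] [AddCommGroup V]
  [Module k V] {bm : M → M → M} {tr : M → V → V}

theorem isBilin_semidirect (hb : IsBilin k bm) (htr : IsBilin k tr) :
    IsBilin k (fun p q : M × V => (bm p.1 q.1, tr p.1 q.2 - tr q.1 p.2)) := by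
  obtain ⟨b1, b2, b3, b4⟩ := hb
  obtain ⟨t1, t2, t3, t4⟩ := htr
  refine ⟨fun x y z => ?_, fun c x z => ?_, fun x y z => ?_, fun c x z => ?_⟩ <;>
    ext <;> simp [*, smul_sub] <;> abel

/-- The defect of the module condition. -/
def moduleDefect (bm : M → M → M) (tr : M → V → V) (x y z : M) (q : V) : V :=
  tr (bm x z) (tr y q) - (tr (bm (bm x y) z) q - tr x (tr (bm y z) q)
      + tr y (tr x (tr z q)) - tr z (tr y (tr x q)))

theorem sagleDefect_semidirect (ha : ∀ x y, bm x y = -bm y x)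
    (htr : IsBilin k tr) (x y z t : M × V) :
    sagleDefect (fun p q : M × V => (bm p.1 q.1, tr p.1 q.2 - tr q.1 p.2)) x y z t =
      (sagleDefect bm x.1 y.1 z.1 t.1,
        moduleDefect bm tr x.1 y.1 z.1 t.2 + moduleDefect bm tr y.1 z.1 t.1 x.2
        + moduleDefect bm tr z.1 t.1 x.1 y.2 + moduleDefect bm tr t.1 x.1 y.1 z.2) := by
  ext
  · simp [sagleDefect]
  · simp only [sagleDefect, moduleDefect, Prod.snd_sub, Prod.snd_add, htr.sub_right]
    rw [ha z.1 x.1, ha t.1 y.1]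
    simp only [htr.neg_left]
    abel

end Semidirect

theorem stmt1 {k : Type*} [Field k] (h2 : (2 : k) ≠ 0) (h3 : (3 : k) ≠ 0) {M V : Type*} [AddCommGroup M] [Module k M] [AddCommGroup V] [Module k V]
    (bm : M → M → M) (hbm : IsMalcevBracket k bm)
    (tr : M → V → V) (htr : IsBilin k tr) :
    IsMalcevBracket k
      (fun p q : M × V => (bm p.1 q.1, tr p.1 q.2 - tr q.1 p.2)) ↔
    (∀ (x y z : M) (q : V),
      tr (bm x z) (tr y q) =
      tr (bm (bm x y) z) q - tr x (tr (bm y z) q)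
      + tr y (tr x (tr z q)) - tr z (tr y (tr x q))) := by
  obtain ⟨hb, ha, hm⟩ := hbm
  have hB := isBilin_semidirect hb htr
  have hA : ∀ p q : M × V, (bm p.1 q.1, tr p.1 q.2 - tr q.1 p.2)
      = -(bm q.1 p.1, tr q.1 p.2 - tr p.1 q.2) := fun p q => by
    ext
    · exact ha _ _
    · simp
  rw [malcev_iff_sagleDefect_eq_zero h2 hb ha] at hm
  have hdef : ∀ x y z q, tr (bm x z) (tr y q) = tr (bm (bm x y) z) q - tr x (tr (bm y z) q)
      + tr y (tr x (tr z q)) - tr z (tr y (tr x q)) ↔ moduleDefect bm tr x y z q = 0 :=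
    fun x y z q => sub_eq_zero.symm
  simp only [hdef]
  constructor
  · rintro ⟨-, -, h⟩ x y z q
    rw [malcev_iff_sagleDefect_eq_zero h2 hB hA] at h
    have hq := congrArg Prod.snd (h (x, 0) (y, 0) (z, 0) (0, q))
    rw [sagleDefect_semidirect ha htr] at hq
    simpa [moduleDefect, htr.zero_right] using hq
  · intro h
    refine ⟨hB, hA, (malcev_iff_sagleDefect_eq_zero h2 hB hA).mpr fun x y z t => ?_⟩
    rw [sagleDefect_semidirect ha htr]
    simp [hm, h]
end

section
/- Let M be a Malcev algebra over k, V a k-vector space, and let an extending datum (⊲,▷,ω,{·,·}) be given such that the unified product bracket on M⊕V is a Malcev algebra bracket. Then for all x,y,z ∈ M and q ∈ V: [[x,z], y⊲q] + [x,z]⊲(y▷q) = [[x,y],z]⊲q + [[y,z]⊲q, x] − x⊲([y,z]▷q) + [[z⊲q,x],y] − [x⊲(z▷q),y] + y⊲(x▷(z▷q)) − [[x⊲q,y],z] + [y⊲(x▷q),z] − z⊲(y▷(x▷q)). -/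
def ubr {M V : Type*} [AddCommGroup M] [AddCommGroup V]
    (bm : M → M → M) (tl : M → V → M) (tr : M → V → V)
    (om : V → V → M) (bv : V → V → V) :
    M × V → M × V → M × V :=
  fun p q =>
    (bm p.1 q.1 + tl p.1 q.2 - tl q.1 p.2 + om p.2 q.2,
     tr p.1 q.2 - tr q.1 p.2 + bv p.2 q.2)

namespace IsBilin

variable {k : Type*} [Field k] {A B C : Type*} [AddCommGroup A] [Module k A]
  [AddCommGroup B] [Module k B] [AddCommGroup C] [Module k C] {f : A → B → C}

theorem map_zero_left (hf : IsBilin k f) (b : B) : f 0 b = 0 := by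
  simpa using hf.2.1 0 0 b

theorem map_zero_right (hf : IsBilin k f) (a : A) : f a 0 = 0 := by
  simpa using hf.2.2.2 0 a 0

theorem map_neg_left (hf : IsBilin k f) (a : A) (b : B) : f (-a) b = -f a b := by
  simpa using hf.2.1 (-1) a b

theorem map_neg_right (hf : IsBilin k f) (a : A) (b : B) : f a (-b) = -f a b := by
  simpa using hf.2.2.2 (-1) a b

theorem map_sub_left (hf : IsBilin k f) (a a' : A) (b : B) :
    f (a - a') b = f a b - f a' b := by
  rw [sub_eq_add_neg, hf.1, hf.map_neg_left, ← sub_eq_add_neg]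

end IsBilin

namespace IsMalcevBracket

variable {k : Type*} [Field k] {A : Type*} [AddCommGroup A] [Module k A] {br : A → A → A}

/-- The Malcev identity, polarized in its repeated variable. -/
theorem polarized (h : IsMalcevBracket k br) (x w y z : A) :
    jacF br x y (br w z) + jacF br w y (br x z) =
      br (jacF br x y z) w + br (jacF br w y z) x := by
  obtain ⟨⟨addl, -, addr, -⟩, -, mal⟩ := h
  have hx := mal x y z
  have hw := mal w y z
  have hxw := mal (x + w) y z
  simp only [jacF, addl, addr] at hx hw hxw ⊢
  linear_combination (norm := module) hxw - hx - hw

/-- Sagle's identity, which characterizes Malcev algebras in characteristic different from 2. -/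
theorem sagle (h2 : (2 : k) ≠ 0) (h : IsMalcevBracket k br) (x y z w : A) :
    br (br x z) (br y w) = br (br (br x y) z) w + br (br (br y z) w) x +
      br (br (br z w) x) y + br (br (br w x) y) z := by
  have h₁ := h.polarized x y z w
  have h₂ := h.polarized x z w y
  have h₃ := h.polarized w x y z
  obtain ⟨hb, anti, -⟩ := h
  have flip (a b c : A) : br a (br b c) = -br (br b c) a := anti _ _
  simp only [jacF, hb.1, flip y, flip z, flip w, anti y x, anti z x, anti w x,
    anti z y, anti w y, anti w z, hb.map_neg_left, hb.map_neg_right,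
    anti (br z w) (br x y), anti (br y w) (br x z), anti (br y z) (br x w)] at h₁ h₂ h₃ ⊢
  apply smul_right_injective A h2
  linear_combination (norm := module) h₁ - h₂ + h₃

end IsMalcevBracket

theorem stmt3 {k : Type*} [Field k] (h2 : (2 : k) ≠ 0) (h3 : (3 : k) ≠ 0) {M V : Type*} [AddCommGroup M] [Module k M] [AddCommGroup V] [Module k V]
    (bm : M → M → M) (hbm : IsMalcevBracket k bm)
    (tl : M → V → M) (htl : IsBilin k tl)
    (tr : M → V → V) (htr : IsBilin k tr)
    (om : V → V → M) (hom : IsBilin k om) (homa : ∀ u v : V, om u v = - om v u)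
    (bv : V → V → V) (hbv : IsBilin k bv) (hbva : ∀ u v : V, bv u v = - bv v u)
    (huni : IsMalcevBracket k (ubr bm tl tr om bv)) :
    ∀ (x y z : M) (q : V),
      bm (bm x z) (tl y q) + tl (bm x z) (tr y q) =
      tl (bm (bm x y) z) q + bm (tl (bm y z) q) x - tl x (tr (bm y z) q)
      + bm (bm (tl z q) x) y - bm (tl x (tr z q)) y + tl y (tr x (tr z q))
      - bm (bm (tl x q) y) z + bm (tl y (tr x q)) z - tl z (tr y (tr x q)) := by
  intro x y z q
  have h := congrArg Prod.fst (huni.sagle h2 (x, 0) (y, 0) (z, 0) (0, q))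
  simp only [ubr, hbm.1.map_zero_left, hbm.1.map_zero_right, htl.map_zero_left,
    htl.map_zero_right, htr.map_zero_left, htr.map_zero_right, hom.map_zero_left,
    hom.map_zero_right, hbv.map_zero_left, hbv.map_zero_right, Prod.fst_add, add_zero, zero_add,
    sub_zero, zero_sub, neg_neg, hbm.1.map_neg_left, hbm.1.map_sub_left,
    htl.map_neg_right, htr.map_neg_right] at h
  rw [h]
  abel
end

section
/- Let M be a Malcev algebra over k, V a k-vector space, and let an extending datum (⊲,▷,ω,{·,·}) be given such that the unified product bracket on M⊕V is a Malcev algebra bracket. Then for all x,z ∈ M and v,q ∈ V: [[x,z], ω(v,q)] + [x,z]⊲{v,q} = [x⊲v,z]⊲q − (z⊲(x▷v))⊲q − ω(z▷(x▷v), q) − [(z⊲v)⊲q, x] − [ω(z▷v,q), x] + x⊲((z⊲v)▷q) + x⊲{z▷v, q} + [z⊲q,x]⊲v − (x⊲(z▷q))⊲v − ω(x▷(z▷q), v) − [(x⊲q)⊲v, z] − [ω(x▷q,v), z] + z⊲((x⊲q)▷v) + z⊲{x▷q, v}. -/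
theorem IsBilin.map_neg_left_s7 {k A B C : Type*} [Field k] [AddCommGroup A] [Module k A]
    [AddCommGroup B] [Module k B] [AddCommGroup C] [Module k C] {f : A → B → C}
    (hf : IsBilin k f) (x : A) (y : B) : f (-x) y = -f x y := by
  simpa using hf.2.1 (-1) x y

theorem IsBilin.map_neg_right_s7 {k A B C : Type*} [Field k] [AddCommGroup A] [Module k A]
    [AddCommGroup B] [Module k B] [AddCommGroup C] [Module k C] {f : A → B → C}
    (hf : IsBilin k f) (x : A) (y : B) : f x (-y) = -f x y := by
  simpa using hf.2.2.2 (-1) x y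

theorem IsBilin.map_zero_left_s7 {k A B C : Type*} [Field k] [AddCommGroup A] [Module k A]
    [AddCommGroup B] [Module k B] [AddCommGroup C] [Module k C] {f : A → B → C}
    (hf : IsBilin k f) (y : B) : f 0 y = 0 := by
  simpa using hf.2.1 0 0 y

theorem IsBilin.map_zero_right_s7 {k A B C : Type*} [Field k] [AddCommGroup A] [Module k A]
    [AddCommGroup B] [Module k B] [AddCommGroup C] [Module k C] {f : A → B → C}
    (hf : IsBilin k f) (x : A) : f x 0 = 0 := by
  simpa using hf.2.2.2 0 x 0

/-- The linearization of the Malcev identity in its repeated variable. -/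
theorem IsMalcevBracket.linearized {k A : Type*} [Field k] [AddCommGroup A] [Module k A]
    {f : A → A → A} (hf : IsMalcevBracket k f) (x w y z : A) :
    jacF f x y (f w z) + jacF f w y (f x z) = f (jacF f x y z) w + f (jacF f w y z) x := by
  obtain ⟨⟨hl, -, hr, -⟩, -, hm⟩ := hf
  have hxw := hm (x + w) y z
  have hx := hm x y z
  have hw := hm w y z
  simp only [jacF, hl, hr] at hxw hx hw ⊢
  linear_combination (norm := module) hxw - hx - hw

/-- The Sagle identity, valid in characteristic different from two. -/
theorem IsMalcevBracket.sagle_s7 {k A : Type*} [Field k] (h2 : (2 : k) ≠ 0)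
    [AddCommGroup A] [Module k A] {f : A → A → A} (hf : IsMalcevBracket k f) (x y z t : A) :
    f (f x z) (f y t) =
      f (f (f x y) z) t + f (f (f y z) t) x + f (f (f z t) x) y + f (f (f t x) y) z := by
  have h₁ := hf.linearized x y z t
  have h₂ := hf.linearized x z t y
  have h₃ := hf.linearized t x y z
  have hnl := hf.1.map_neg_left_s7
  have hnr := hf.1.map_neg_right_s7
  obtain ⟨⟨hl, -⟩, ha, -⟩ := hf
  have hswap (a b c : A) : f a (f b c) = -f (f b c) a := ha _ _
  rw [← sub_eq_zero]
  refine (smul_eq_zero_iff_right h2).mp ?_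
  simp only [jacF, hl, ha y x, ha z x, ha t x, ha z y, ha t y, ha t z, hnl, hnr,
    neg_neg, hswap y, hswap z, hswap t, ha (f z t) (f x y), ha (f y t) (f x z),
    ha (f y z) (f x t)] at h₁ h₂ h₃ ⊢
  linear_combination (norm := module) h₁ - h₂ + h₃

theorem stmt7 {k : Type*} [Field k] (h2 : (2 : k) ≠ 0) (h3 : (3 : k) ≠ 0) {M V : Type*} [AddCommGroup M] [Module k M] [AddCommGroup V] [Module k V]
    (bm : M → M → M) (hbm : IsMalcevBracket k bm)
    (tl : M → V → M) (htl : IsBilin k tl)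
    (tr : M → V → V) (htr : IsBilin k tr)
    (om : V → V → M) (hom : IsBilin k om) (homa : ∀ u v : V, om u v = - om v u)
    (bv : V → V → V) (hbv : IsBilin k bv) (hbva : ∀ u v : V, bv u v = - bv v u)
    (huni : IsMalcevBracket k (ubr bm tl tr om bv)) :
    ∀ (x z : M) (v q : V),
      bm (bm x z) (om v q) + tl (bm x z) (bv v q) =
      tl (bm (tl x v) z) q - tl (tl z (tr x v)) q - om (tr z (tr x v)) q
      - bm (tl (tl z v) q) x - bm (om (tr z v) q) x
      + tl x (tr (tl z v) q) + tl x (bv (tr z v) q)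
      + tl (bm (tl z q) x) v - tl (tl x (tr z q)) v - om (tr x (tr z q)) v
      - bm (tl (tl x q) v) z - bm (om (tr x q) v) z
      + tl z (tr (tl x q) v) + tl z (bv (tr x q) v) := by
  intro x z v q
  have h := congrArg Prod.fst (huni.sagle_s7 h2 (x, 0) (0, v) (z, 0) (0, q))
  simp only [ubr, Prod.fst_add, htl.map_zero_left_s7, htl.map_zero_right_s7, htr.map_zero_left_s7,
    htr.map_zero_right_s7, hom.map_zero_left_s7, hom.map_zero_right_s7, hbv.map_zero_left_s7,
    hbv.map_zero_right_s7, hbm.1.map_zero_left_s7, hbm.1.map_zero_right_s7, add_zero, zero_add,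
    sub_eq_add_neg, htl.1, htl.2.2.1, htr.1, htr.2.2.1, hbm.1.1, neg_zero,
    htl.map_neg_left_s7, htl.map_neg_right_s7, htr.map_neg_left_s7, htr.map_neg_right_s7, hom.map_neg_left_s7,
    hbm.1.map_neg_left_s7, hbv.map_neg_left_s7, neg_neg, neg_add] at h ⊢
  rw [h]
  abel
end

section
/- Let M be a Malcev algebra over k, V a k-vector space and (⊲,▷,ω,{·,·}) an extending datum. The unified product bracket on M⊕V is a Malcev algebra bracket if and only if the following ten conditions hold. For all x,y,z ∈ M, q ∈ V: (1) [[x,z], y⊲q] + [x,z]⊲(y▷q) = [[x,y],z]⊲q + [[y,z]⊲q, x] − x⊲([y,z]▷q) + [[z⊲q,x],y] − [x⊲(z▷q),y] + y⊲(x▷(z▷q)) − [[x⊲q,y],z] + [y⊲(x▷q),z] − z⊲(y▷(x▷q)); (2) [x,z]▷(y▷q) = [[x,y],z]▷q − x▷([y,z]▷q) + y▷(x▷(z▷q)) − z▷(y▷(x▷q)). For all x,z ∈ M, v,q ∈ V: (3) [[x,z], ω(v,q)] + [x,z]⊲{v,q} = [x⊲v,z]⊲q − (z⊲(x▷v))⊲q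 − ω(z▷(x▷v), q) − [(z⊲v)⊲q, x] − [ω(z▷v,q), x] + x⊲((z⊲v)▷q) + x⊲{z▷v, q} + [z⊲q,x]⊲v − (x⊲(z▷q))⊲v − ω(x▷(z▷q), v) − [(x⊲q)⊲v, z] − [ω(x▷q,v), z] + z⊲((x⊲q)▷v) + z⊲{x▷q, v}; (4) [x,z]▷{v,q} = [x⊲v,z]▷q − (z⊲(x▷v))▷q − {z▷(x▷v), q} + x▷((z⊲v)▷q) + x▷{z▷v, q} + [z⊲q,x]▷v − (x⊲(z▷q))▷v − {x▷(z▷q), v} + z▷((x⊲q)▷v) + z▷{x▷q, v}. For all x,y ∈ M, p,q ∈ V: (5) [x⊲p, y⊲q] + (x⊲p)⊲(y▷q) − (y⊲q)⊲(x▷p) + ω(x▷p, y▷q) = ([x,y]⊲p)⊲q + ω([x,y]▷p, q) + [(y⊲p)⊲q, x] + [ω(y▷p,q), x] − x⊲((y⊲p)▷q) − x⊲{y▷p, q} + [[ω(p,q),x],y] − [x⊲{p,q}, y] + y⊲(x▷{p,q}) − [x⊲q,y]⊲p + (y⊲(x▷q))⊲p + ω(y▷(x▷q), p); (6) {x▷p,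 y▷q} + (x⊲p)▷(y▷q) − (y⊲q)▷(x▷p) = {[x,y]▷p, q} + ([x,y]⊲p)▷q − x▷{y▷p, q} − x▷((y⊲p)▷q) + y▷(x▷{p,q}) + {y▷(x▷q), p} − [x⊲q,y]▷p + (y⊲(x▷q))▷p. For all x ∈ M, p,v,q ∈ V: (7) [x⊲v, ω(p,q)] + (x⊲v)⊲{p,q} − ω(p,q)⊲(x▷v) + ω(x▷v, {p,q}) = ((x⊲p)⊲v)⊲q + ω(x▷p, v)⊲q + ω((x⊲p)▷v, q) + ω({x▷p, v}, q) + [ω(p,v)⊲q, x] + [ω({p,v}, q), x] − x⊲(ω(p,v)▷q) − x⊲{{p,v},q} + [ω(v,q), x]⊲p − (x⊲{v,q})⊲p − ω(x▷{v,q}, p) − ((x⊲q)⊲p)⊲v − ω(x▷q, p)⊲v − ω((x⊲q)▷p, v) − ω({x▷q, p}, v); (8) (x⊲v)▷{p,q} − ω(p,q)▷(x▷v) + {x▷v, {p,q}} = ((x⊲p)⊲v)▷q + ω(x▷p, v)▷q + {(x⊲p)▷v, q} + {{x▷p, v}, q} − x▷(ω(p,v)▷q) − x▷{{p,v}, q}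 + [ω(v,q),x]▷p − (x⊲{v,q})▷p − {x▷{v,q}, p} − ((x⊲q)⊲p)▷v − ω(x▷q,p)▷v − {(x⊲q)▷p, v} − {{x▷q, p}, v}. For all u,p,v,q ∈ V: (9) [ω(u,p), ω(v,q)] + ω(u,p)⊲{v,q} − ω(v,q)⊲{u,p} + ω({u,p},{v,q}) = (ω(u,v)⊲p)⊲q + ω({u,v},p)⊲q + ω({{u,v},p}, q) + ω(ω(u,v)▷p, q) + (ω(v,p)⊲q)⊲u + ω({v,p},q)⊲u + ω({{v,p},q}, u) + ω(ω(v,p)▷q, u) + (ω(p,q)⊲u)⊲v + ω({p,q},u)⊲v + ω({{p,q},u}, v) + ω(ω(p,q)▷u, v) + (ω(q,u)⊲v)⊲p + ω({q,u},v)⊲p + ω({{q,u},v}, p) + ω(ω(q,u)▷v, p); (10) {{u,p},{v,q}} + ω(u,p)▷{v,q} − ω(v,q)▷{u,p} = {{{u,v},p}, q} + {ω(u,v)▷p, q} + (ω(u,v)⊲p)▷q + ω({u,v},p)▷q + {{{v,p},q}, u} + {ω(v,p)▷q, u} + (ω(v,p)⊲q)▷u + ω({v,p},q)▷u + {{{p,q},u},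 v} + {ω(p,q)▷u, v} + (ω(p,q)⊲u)▷v + ω({p,q},u)▷v + {{{q,u},v}, p} + {ω(q,u)▷v, p} + (ω(q,u)⊲v)▷p + ω({q,u},v)▷p. -/
namespace IsBilin

variable {k A B C : Type*} [Field k] [AddCommGroup A] [Module k A] [AddCommGroup B] [Module k B]
  [AddCommGroup C] [Module k C] {f : A → B → C}

theorem add_left_s11 (h : IsBilin k f) (x y : A) (z : B) : f (x + y) z = f x z + f y z :=
  h.1 x y z

theorem add_right_s11 (h : IsBilin k f) (x : A) (y z : B) : f x (y + z) = f x y + f x z :=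
  h.2.2.1 x y z

theorem zero_left_s11 (h : IsBilin k f) (z : B) : f 0 z = 0 := by
  simpa using h.2.1 0 0 z

theorem zero_right_s11 (h : IsBilin k f) (x : A) : f x 0 = 0 := by
  simpa using h.2.2.2 0 x 0

theorem neg_left_s11 (h : IsBilin k f) (x : A) (z : B) : f (-x) z = -f x z := by
  simpa using h.2.1 (-1) x z

theorem neg_right_s11 (h : IsBilin k f) (x : A) (z : B) : f x (-z) = -f x z := by
  simpa using h.2.2.2 (-1) x z

theorem sub_left (h : IsBilin k f) (x y : A) (z : B) : f (x - y) z = f x z - f y z := by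
  rw [sub_eq_add_neg, h.add_left_s11, h.neg_left_s11, sub_eq_add_neg]

end IsBilin

section Sagle

variable {k A : Type*} [Field k] [AddCommGroup A] [Module k A] {br : A → A → A}

theorem sagleDefect_cyclic (hb : IsBilin k br) (ha : ∀ x y, br x y = -br y x) (x y z t : A) :
    sagleDefect br x y z t = sagleDefect br y z t x := by
  unfold sagleDefect
  rw [ha (br y t) (br z x), ha z x, hb.neg_left_s11]
  abel

theorem sagleDefect_add_first (hb : IsBilin k br) (x x' y z t : A) :
    sagleDefect br (x + x') y z t = sagleDefect br x y z t + sagleDefect br x' y z t := by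
  simp only [sagleDefect, hb.add_left_s11, hb.add_right_s11]
  abel

theorem malcev_linearized (hb : IsBilin k br)
    (hm : ∀ x y z, jacF br x y (br x z) = br (jacF br x y z) x) (x w y z : A) :
    jacF br x y (br w z) + jacF br w y (br x z)
      = br (jacF br x y z) w + br (jacF br w y z) x := by
  have h := hm (x + w) y z
  have hx := hm x y z
  have hw := hm w y z
  simp only [jacF, hb.add_left_s11, hb.add_right_s11] at h hx hw ⊢
  linear_combination (norm := module) h - hx - hw

theorem sagleDefect_eq_zero_of_malcev (h2 : (2 : k) ≠ 0) (hb : IsBilin k br)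
    (ha : ∀ x y, br x y = -br y x)
    (hm : ∀ x y z, jacF br x y (br x z) = br (jacF br x y z) x) (x y z t : A) :
    sagleDefect br x y z t = 0 := by
  have h1 := malcev_linearized hb hm x y z t
  have h3 := malcev_linearized hb hm x z t y
  have h4 := malcev_linearized hb hm t x y z
  have key : (2 : k) • sagleDefect br x y z t = 0 := by
    simp only [jacF, sagleDefect, hb.add_left_s11, ha y x, ha z x, ha t x, ha z y, ha t y, ha t z,
      ha y (br _ _), ha z (br _ _), ha t (br _ _), hb.neg_left_s11, hb.neg_right_s11,
      ha (br y z) (br x t), ha (br y t) (br x z), ha (br z t) (br x y)] at h1 h3 h4 ⊢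
    linear_combination (norm := module) h1 - h3 + h4
  exact (smul_eq_zero.mp key).resolve_left h2

theorem malcev_of_sagleDefect_eq_zero (h2 : (2 : k) ≠ 0) (hb : IsBilin k br)
    (ha : ∀ x y, br x y = -br y x) (hs : ∀ x y z t, sagleDefect br x y z t = 0) (x y z : A) :
    jacF br x y (br x z) = br (jacF br x y z) x := by
  have hself : br x x = 0 := by
    have h : (2 : k) • br x x = 0 := by
      rw [two_smul]; nth_rewrite 1 [ha x x]; exact neg_add_cancel _
    exact (smul_eq_zero.mp h).resolve_left h2
  have h := hs x x y z
  simp only [jacF, sagleDefect, hb.add_left_s11, hself, hb.zero_left_s11, ha z x, ha y (br x z),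
    hb.neg_left_s11] at h ⊢
  linear_combination (norm := module) h

theorem isMalcevBracket_iff_sagleDefect (h2 : (2 : k) ≠ 0) (hb : IsBilin k br)
    (ha : ∀ x y, br x y = -br y x) :
    IsMalcevBracket k br ↔ ∀ x y z t, sagleDefect br x y z t = 0 :=
  ⟨fun h => sagleDefect_eq_zero_of_malcev h2 hb ha h.2.2,
    fun h => ⟨hb, ha, malcev_of_sagleDefect_eq_zero h2 hb ha h⟩⟩

end Sagle

section UnifiedProduct

variable {k M V : Type*} [Field k] [AddCommGroup M] [Module k M] [AddCommGroup V] [Module k V]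
  {bm : M → M → M} {tl : M → V → M} {tr : M → V → V} {om : V → V → M} {bv : V → V → V}

theorem isBilin_ubr (hbm : IsBilin k bm) (htl : IsBilin k tl) (htr : IsBilin k tr)
    (hom : IsBilin k om) (hbv : IsBilin k bv) : IsBilin k (ubr bm tl tr om bv) := by
  refine ⟨fun x y z => ?_, fun c x z => ?_, fun x y z => ?_, fun c x z => ?_⟩
  · ext
    · simp only [ubr, Prod.fst_add, Prod.snd_add, hbm.add_left_s11, htl.add_left_s11, htl.add_right_s11,
        hom.add_left_s11]
      abel
    · simp only [ubr, Prod.fst_add, Prod.snd_add, htr.add_left_s11, htr.add_right_s11, hbv.add_left_s11]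
      abel
  · ext
    · simp only [ubr, Prod.smul_fst, Prod.smul_snd, hbm.2.1, htl.2.1, htl.2.2.2, hom.2.1]
      module
    · simp only [ubr, Prod.smul_fst, Prod.smul_snd, htr.2.1, htr.2.2.2, hbv.2.1]
      module
  · ext
    · simp only [ubr, Prod.fst_add, Prod.snd_add, hbm.add_right_s11, htl.add_left_s11, htl.add_right_s11,
        hom.add_right_s11]
      abel
    · simp only [ubr, Prod.fst_add, Prod.snd_add, htr.add_left_s11, htr.add_right_s11, hbv.add_right_s11]
      abel
  · ext
    · simp only [ubr, Prod.smul_fst, Prod.smul_snd, hbm.2.2.2, htl.2.1, htl.2.2.2, hom.2.2.2]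
      module
    · simp only [ubr, Prod.smul_fst, Prod.smul_snd, htr.2.1, htr.2.2.2, hbv.2.2.2]
      module

theorem ubr_antisymm (hbma : ∀ x y, bm x y = -bm y x) (homa : ∀ u v, om u v = -om v u)
    (hbva : ∀ u v, bv u v = -bv v u) (p q : M × V) :
    ubr bm tl tr om bv p q = -ubr bm tl tr om bv q p := by
  ext
  · simp only [ubr, Prod.fst_neg, hbma p.1 q.1, homa p.2 q.2]
    abel
  · simp only [ubr, Prod.snd_neg, hbva p.2 q.2]
    abel

/-- A cyclically invariant additive expression on `M × V` vanishes as soon as it vanishes on one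
representative of each cyclic class of homogeneous arguments. -/
theorem forall_eq_zero_iff_of_cyclic {B : Type*} [AddCommGroup B]
    {S : M × V → M × V → M × V → M × V → B} (hcyc : ∀ x y z t, S x y z t = S y z t x)
    (hadd : ∀ x x' y z t, S (x + x') y z t = S x y z t + S x' y z t) :
    (∀ x y z t, S x y z t = 0) ↔
      (∀ x y z t : M, S (x, 0) (y, 0) (z, 0) (t, 0) = 0) ∧
      (∀ (x y z : M) (q : V), S (x, 0) (y, 0) (z, 0) (0, q) = 0) ∧
      (∀ (x z : M) (v q : V), S (x, 0) (0, v) (z, 0) (0, q) = 0) ∧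
      (∀ (x y : M) (p q : V), S (x, 0) (y, 0) (0, p) (0, q) = 0) ∧
      (∀ (x : M) (p v q : V), S (x, 0) (0, p) (0, v) (0, q) = 0) ∧
      (∀ u v p q : V, S (0, u) (0, v) (0, p) (0, q) = 0) := by
  refine ⟨fun h => ⟨fun _ _ _ _ => h _ _ _ _, fun _ _ _ _ => h _ _ _ _, fun _ _ _ _ => h _ _ _ _,
    fun _ _ _ _ => h _ _ _ _, fun _ _ _ _ => h _ _ _ _, fun _ _ _ _ => h _ _ _ _⟩, ?_⟩
  rintro ⟨h0, h1, ho, ha, h3, h4⟩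
  have split (y z t : M × V) (hM : ∀ a : M, S (a, 0) y z t = 0) (hV : ∀ b : V, S (0, b) y z t = 0)
      (x : M × V) : S x y z t = 0 := by
    have hx : x = (x.1, 0) + (0, x.2) := by simp
    rw [hx, hadd, hM, hV, add_zero]
  have rot {x y z t : M × V} (h : S y z t x = 0) : S x y z t = 0 := (hcyc x y z t).trans h
  intro x y z t
  refine split y z t (fun a => rot (split z t _ (fun b => rot (split t _ _ (fun c =>
    rot (split _ _ _ (fun d => ?_) (fun d => ?_) t)) (fun c =>
    rot (split _ _ _ (fun d => ?_) (fun d => ?_) t)) z)) (fun b => rot (split t _ _ (fun c =>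
    rot (split _ _ _ (fun d => ?_) (fun d => ?_) t)) (fun c =>
    rot (split _ _ _ (fun d => ?_) (fun d => ?_) t)) z)) y)) (fun a =>
    rot (split z t _ (fun b => rot (split t _ _ (fun c =>
    rot (split _ _ _ (fun d => ?_) (fun d => ?_) t)) (fun c =>
    rot (split _ _ _ (fun d => ?_) (fun d => ?_) t)) z)) (fun b => rot (split t _ _ (fun c =>
    rot (split _ _ _ (fun d => ?_) (fun d => ?_) t)) (fun c =>
    rot (split _ _ _ (fun d => ?_) (fun d => ?_) t)) z)) y)) x
  all_goals
    first
    | simp only [h0, h1, ho, ha, h3, h4]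
    | exact rot (by simp only [h1, ho, ha, h3])
    | exact rot (rot (by simp only [h1, ha, h3]))
    | exact rot (rot (rot (by simp only [h1, ha, h3])))

end UnifiedProduct

theorem stmt11 {k : Type*} [Field k] (h2 : (2 : k) ≠ 0) (h3 : (3 : k) ≠ 0) {M V : Type*} [AddCommGroup M] [Module k M] [AddCommGroup V] [Module k V]
    (bm : M → M → M) (hbm : IsMalcevBracket k bm)
    (tl : M → V → M) (htl : IsBilin k tl)
    (tr : M → V → V) (htr : IsBilin k tr)
    (om : V → V → M) (hom : IsBilin k om) (homa : ∀ u v : V, om u v = - om v u)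
    (bv : V → V → V) (hbv : IsBilin k bv) (hbva : ∀ u v : V, bv u v = - bv v u) :
    IsMalcevBracket k (ubr bm tl tr om bv) ↔
    ((∀ (x y z : M) (q : V),
      bm (bm x z) (tl y q) + tl (bm x z) (tr y q) =
      tl (bm (bm x y) z) q + bm (tl (bm y z) q) x - tl x (tr (bm y z) q)
      + bm (bm (tl z q) x) y - bm (tl x (tr z q)) y + tl y (tr x (tr z q))
      - bm (bm (tl x q) y) z + bm (tl y (tr x q)) z - tl z (tr y (tr x q))) ∧
    (∀ (x y z : M) (q : V),
      tr (bm x z) (tr y q) =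
      tr (bm (bm x y) z) q - tr x (tr (bm y z) q)
      + tr y (tr x (tr z q)) - tr z (tr y (tr x q))) ∧
    (∀ (x z : M) (v q : V),
      bm (bm x z) (om v q) + tl (bm x z) (bv v q) =
      tl (bm (tl x v) z) q - tl (tl z (tr x v)) q - om (tr z (tr x v)) q
      - bm (tl (tl z v) q) x - bm (om (tr z v) q) x
      + tl x (tr (tl z v) q) + tl x (bv (tr z v) q)
      + tl (bm (tl z q) x) v - tl (tl x (tr z q)) v - om (tr x (tr z q)) v
      - bm (tl (tl x q) v) z - bm (om (tr x q) v) z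
      + tl z (tr (tl x q) v) + tl z (bv (tr x q) v)) ∧
    (∀ (x z : M) (v q : V),
      tr (bm x z) (bv v q) =
      tr (bm (tl x v) z) q - tr (tl z (tr x v)) q - bv (tr z (tr x v)) q
      + tr x (tr (tl z v) q) + tr x (bv (tr z v) q)
      + tr (bm (tl z q) x) v - tr (tl x (tr z q)) v - bv (tr x (tr z q)) v
      + tr z (tr (tl x q) v) + tr z (bv (tr x q) v)) ∧
    (∀ (x y : M) (p q : V),
      bm (tl x p) (tl y q) + tl (tl x p) (tr y q) - tl (tl y q) (tr x p) + om (tr x p) (tr y q) =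
      tl (tl (bm x y) p) q + om (tr (bm x y) p) q + bm (tl (tl y p) q) x + bm (om (tr y p) q) x
      - tl x (tr (tl y p) q) - tl x (bv (tr y p) q)
      + bm (bm (om p q) x) y - bm (tl x (bv p q)) y + tl y (tr x (bv p q))
      - tl (bm (tl x q) y) p + tl (tl y (tr x q)) p + om (tr y (tr x q)) p) ∧
    (∀ (x y : M) (p q : V),
      bv (tr x p) (tr y q) + tr (tl x p) (tr y q) - tr (tl y q) (tr x p) =
      bv (tr (bm x y) p) q + tr (tl (bm x y) p) q - tr x (bv (tr y p) q) - tr x (tr (tl y p) q)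
      + tr y (tr x (bv p q)) + bv (tr y (tr x q)) p - tr (bm (tl x q) y) p + tr (tl y (tr x q)) p) ∧
    (∀ (x : M) (p v q : V),
      bm (tl x v) (om p q) + tl (tl x v) (bv p q) - tl (om p q) (tr x v) + om (tr x v) (bv p q) =
      tl (tl (tl x p) v) q + tl (om (tr x p) v) q + om (tr (tl x p) v) q + om (bv (tr x p) v) q
      + bm (tl (om p v) q) x + bm (om (bv p v) q) x - tl x (tr (om p v) q) - tl x (bv (bv p v) q)
      + tl (bm (om v q) x) p - tl (tl x (bv v q)) p - om (tr x (bv v q)) p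
      - tl (tl (tl x q) p) v - tl (om (tr x q) p) v - om (tr (tl x q) p) v - om (bv (tr x q) p) v) ∧
    (∀ (x : M) (p v q : V),
      tr (tl x v) (bv p q) - tr (om p q) (tr x v) + bv (tr x v) (bv p q) =
      tr (tl (tl x p) v) q + tr (om (tr x p) v) q + bv (tr (tl x p) v) q + bv (bv (tr x p) v) q
      - tr x (tr (om p v) q) - tr x (bv (bv p v) q)
      + tr (bm (om v q) x) p - tr (tl x (bv v q)) p - bv (tr x (bv v q)) p
      - tr (tl (tl x q) p) v - tr (om (tr x q) p) v - bv (tr (tl x q) p) v - bv (bv (tr x q) p) v) ∧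
    (∀ (u p v q : V),
      bm (om u p) (om v q) + tl (om u p) (bv v q) - tl (om v q) (bv u p) + om (bv u p) (bv v q) =
      tl (tl (om u v) p) q + tl (om (bv u v) p) q + om (bv (bv u v) p) q + om (tr (om u v) p) q
      + tl (tl (om v p) q) u + tl (om (bv v p) q) u + om (bv (bv v p) q) u + om (tr (om v p) q) u
      + tl (tl (om p q) u) v + tl (om (bv p q) u) v + om (bv (bv p q) u) v + om (tr (om p q) u) v
      + tl (tl (om q u) v) p + tl (om (bv q u) v) p + om (bv (bv q u) v) p + om (tr (om q u) v) p) ∧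
    (∀ (u p v q : V),
      bv (bv u p) (bv v q) + tr (om u p) (bv v q) - tr (om v q) (bv u p) =
      bv (bv (bv u v) p) q + bv (tr (om u v) p) q + tr (tl (om u v) p) q + tr (om (bv u v) p) q
      + bv (bv (bv v p) q) u + bv (tr (om v p) q) u + tr (tl (om v p) q) u + tr (om (bv v p) q) u
      + bv (bv (bv p q) u) v + bv (tr (om p q) u) v + tr (tl (om p q) u) v + tr (om (bv p q) u) v
      + bv (bv (bv q u) v) p + bv (tr (om q u) v) p + tr (tl (om q u) v) p + tr (om (bv q u) v) p)) := by
  have hub := isBilin_ubr hbm.1 htl htr hom hbv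
  have hua := ubr_antisymm (tl := tl) (tr := tr) hbm.2.1 homa hbva
  have hsM := (isMalcevBracket_iff_sagleDefect h2 hbm.1 hbm.2.1).1 hbm
  rw [isMalcevBracket_iff_sagleDefect h2 hub hua,
    forall_eq_zero_iff_of_cyclic (sagleDefect_cyclic hub hua) (sagleDefect_add_first hub)]
  simp only [Prod.ext_iff, Prod.fst_zero, Prod.snd_zero, sagleDefect, ubr, hbm.1.zero_left_s11,
    hbm.1.zero_right_s11, htl.zero_left_s11, htl.zero_right_s11, htr.zero_left_s11, htr.zero_right_s11, hom.zero_left_s11,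
    hom.zero_right_s11, hbv.zero_left_s11, hbv.zero_right_s11, hbm.1.neg_left_s11, hbm.1.add_left_s11, hbm.1.sub_left,
    htl.neg_left_s11, htl.neg_right_s11, htl.add_left_s11, htl.add_right_s11, htl.sub_left, htr.neg_left_s11,
    htr.neg_right_s11, htr.add_left_s11, htr.add_right_s11, htr.sub_left, hom.neg_left_s11, hom.add_left_s11,
    hbv.neg_left_s11, hbv.add_left_s11, Prod.fst_add, Prod.snd_add, Prod.fst_sub, Prod.snd_sub, zero_add,
    add_zero, zero_sub, sub_zero]
  constructor
  · rintro ⟨-, h1, ho, ha, h3, h4⟩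
    refine ⟨fun x y z q => ?_, fun x y z q => ?_, fun x z v q => ?_, fun x z v q => ?_,
      fun x y p q => ?_, fun x y p q => ?_, fun x p v q => ?_, fun x p v q => ?_,
      fun u p v q => ?_, fun u p v q => ?_⟩
    · linear_combination (norm := module) (h1 x y z q).1
    · linear_combination (norm := module) (h1 x y z q).2
    · linear_combination (norm := module) (ho x z v q).1
    · linear_combination (norm := module) (ho x z v q).2
    · linear_combination (norm := module) (ha x y p q).1
    · linear_combination (norm := module) (ha x y p q).2
    · linear_combination (norm := module) (h3 x p v q).1
    · linear_combination (norm := module) (h3 x p v q).2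
    · linear_combination (norm := module) (h4 u v p q).1
    · linear_combination (norm := module) (h4 u v p q).2
  · rintro ⟨c1, c2, c3, c4, c5, c6, c7, c8, c9, c10⟩
    refine ⟨fun x y z t => ⟨?_, ?_⟩, fun x y z q => ⟨?_, ?_⟩, fun x z v q => ⟨?_, ?_⟩,
      fun x y p q => ⟨?_, ?_⟩, fun x p v q => ⟨?_, ?_⟩, fun u v p q => ⟨?_, ?_⟩⟩
    · exact hsM x y z t
    · trivial
    · linear_combination (norm := module) c1 x y z q
    · linear_combination (norm := module) c2 x y z q
    · linear_combination (norm := module) c3 x z v q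
    · linear_combination (norm := module) c4 x z v q
    · linear_combination (norm := module) c5 x y p q
    · linear_combination (norm := module) c6 x y p q
    · linear_combination (norm := module) c7 x p v q
    · linear_combination (norm := module) c8 x p v q
    · linear_combination (norm := module) c9 u p v q
    · linear_combination (norm := module) c10 u p v q
end

section
/- Let E be a Malcev algebra over k, M ⊆ E a Malcev subalgebra, and V ⊆ E a linear complement of M in E. Then there exist bilinear maps ⊲ : M×V→M, ▷ : M×V→V and antisymmetric bilinear maps ω : V×V→M, {·,·} : V×V→V such that the bracket [(x,u),(y,v)] = ([x,y] + x⊲v − y⊲u + ω(u,v), x▷v − y▷u + {u,v}) makes M⊕V a Malcev algebra, and the linear map φ : M⊕V → E, φ(x,u) = x + u, is an isomorphism of Malcev algebras which stabilizes M (φ(x,0) = x for all x ∈ M) and co-stabilizes V (π(φ(x,u)) = u for all x ∈ M, u ∈ V, where π : E→V is the projection along M). -/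
/-- A bilinear map stays bilinear after composing it with linear maps on both inputs and on the
output. -/
theorem IsBilin.comp_linear {k A B C A' B' C' : Type*} [Field k]
    [AddCommGroup A] [Module k A] [AddCommGroup B] [Module k B] [AddCommGroup C] [Module k C]
    [AddCommGroup A'] [Module k A'] [AddCommGroup B'] [Module k B']
    [AddCommGroup C'] [Module k C'] {f : A → B → C} (hf : IsBilin k f)
    (a : A' →ₗ[k] A) (b : B' →ₗ[k] B) (c : C →ₗ[k] C') :
    IsBilin k fun x y => c (f (a x) (b y)) := by
  obtain ⟨add_left, smul_left, add_right, smul_right⟩ := hf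
  refine ⟨?_, ?_, ?_, ?_⟩ <;> intros <;> simp [add_left, smul_left, add_right, smul_right]

/-- A bracket that an injective linear map intertwines with a Malcev bracket is itself Malcev. -/
theorem IsMalcevBracket.of_injective {k A B : Type*} [Field k]
    [AddCommGroup A] [Module k A] [AddCommGroup B] [Module k B]
    {br : B → B → B} (hbr : IsMalcevBracket k br) {br' : A → A → A}
    (φ : A →ₗ[k] B) (hφ : Function.Injective φ)
    (map_br : ∀ p q, φ (br' p q) = br (φ p) (φ q)) :
    IsMalcevBracket k br' := by
  obtain ⟨⟨add_left, smul_left, add_right, smul_right⟩, anti, malcev⟩ := hbr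
  have map_jac (x y z : A) : φ (jacF br' x y z) = jacF br (φ x) (φ y) (φ z) := by
    simp [jacF, map_br]
  refine ⟨⟨?_, ?_, ?_, ?_⟩, ?_, ?_⟩ <;> intros <;> apply hφ
  · simp [map_br, add_left]
  · simp [map_br, smul_left]
  · simp [map_br, add_right]
  · simp [map_br, smul_right]
  · rw [map_neg, map_br, map_br, anti]
  · rw [map_jac, map_br, map_br, map_jac, malcev]

theorem stmt14 {k : Type*} [Field k] (h2 : (2 : k) ≠ 0) (h3 : (3 : k) ≠ 0)
    {E : Type*} [AddCommGroup E] [Module k E]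
    (br : E → E → E) (hbr : IsMalcevBracket k br)
    (M V : Submodule k E) (hMV : IsCompl M V)
    (hsub : ∀ x y : E, x ∈ M → y ∈ M → br x y ∈ M) :
    ∃ (tl : ↥M → ↥V → ↥M) (tr : ↥M → ↥V → ↥V) (om : ↥V → ↥V → ↥M) (bv : ↥V → ↥V → ↥V),
      IsBilin k tl ∧ IsBilin k tr ∧ IsBilin k om ∧ IsBilin k bv ∧
      (∀ u v : ↥V, om u v = - om v u) ∧ (∀ u v : ↥V, bv u v = - bv v u) ∧
      IsMalcevBracket k
        (ubr (fun x y : ↥M => (⟨br x y, hsub x y x.2 y.2⟩ : ↥M)) tl tr om bv) ∧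
      IsLinearMap k (fun z : ↥M × ↥V => (z.1 : E) + (z.2 : E)) ∧
      Function.Bijective (fun z : ↥M × ↥V => (z.1 : E) + (z.2 : E)) ∧
      (∀ p q : ↥M × ↥V,
        ((ubr (fun x y : ↥M => (⟨br x y, hsub x y x.2 y.2⟩ : ↥M)) tl tr om bv p q).1 : E)
          + ((ubr (fun x y : ↥M => (⟨br x y, hsub x y x.2 y.2⟩ : ↥M)) tl tr om bv p q).2 : E)
        = br ((p.1 : E) + (p.2 : E)) ((q.1 : E) + (q.2 : E))) ∧
      (∀ x : ↥M, ((x : E) + ((0 : ↥V) : E)) = (x : E)) ∧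
      (∀ (x : ↥M) (u : ↥V),
        Submodule.linearProjOfIsCompl V M hMV.symm ((x : E) + (u : E)) = u) := by
  obtain ⟨hbil, anti, -⟩ := id hbr
  obtain ⟨add_left, -, add_right, -⟩ := id hbil
  let P := M.projectionOnto V hMV
  let Q := V.projectionOnto M hMV.symm
  have decomp (e : E) : (P e : E) + (Q e : E) = e :=
    Submodule.projection_add_projection_eq_self hMV e
  let φ : (M × V) ≃ₗ[k] E := M.prodEquivOfIsCompl V hMV
  have map_br (p q : M × V) :
      φ (ubr (fun x y : M => (⟨br x y, hsub x y x.2 y.2⟩ : M)) (fun x u => P (br x u))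
        (fun x u => Q (br x u)) (fun u v => P (br u v)) (fun u v => Q (br u v)) p q)
      = br (φ p) (φ q) := by
    obtain ⟨x, u⟩ := p
    obtain ⟨y, v⟩ := q
    simp only [φ, ubr, Submodule.coe_prodEquivOfIsCompl', Submodule.coe_add, Submodule.coe_sub,
      add_left, add_right]
    rw [anti u y]
    linear_combination (norm := abel) decomp (br x v) - decomp (br y u) + decomp (br u v)
  refine ⟨fun x u => P (br x u), fun x u => Q (br x u), fun u v => P (br u v),
    fun u v => Q (br u v), hbil.comp_linear M.subtype V.subtype P,
    hbil.comp_linear M.subtype V.subtype Q, hbil.comp_linear V.subtype V.subtype P,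
    hbil.comp_linear V.subtype V.subtype Q, fun u v => ?_, fun u v => ?_,
    hbr.of_injective φ.toLinearMap φ.injective map_br, φ.toLinearMap.isLinear, φ.bijective,
    map_br, fun x => by simp, fun x u => ?_⟩
  · change P (br u v) = -P (br v u)
    rw [anti, map_neg]
  · change Q (br u v) = -Q (br v u)
    rw [anti, map_neg]
  · change Q (x + u) = u
    simp [Q]
end

section
/- Let M be a Malcev algebra over k (char k ∉ {2,3}) and let (λ,D) and (λ',D') be two pairs of linear maps λ,λ' : M→k, D,D' : M→M such that both associated flag brackets on E = M⊕k, namely [(x,a),(y,b)] = ([x,y] + bD(x) − aD(y), bλ(x) − aλ(y)) and the analogous bracket built from (λ',D'), are Malcev algebra brackets. Then there exists a Malcev algebra isomorphism φ : (E, [·,·]_{(λ,D)}) → (E, [·,·]_{(λ',D')}) satisfying φ(x,0) = (x,0) for all x ∈ M and whose second component satisfies π∘φ = π (where π : E→k is the projection onto the second summand) if and only if λ = λ' and there exists m ∈ M such that D'(x) = [m,x] + D(x) + λ(x)m for all x ∈ M. -/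
def flagBr {k : Type*} [Field k] {M : Type*} [AddCommGroup M] [Module k M]
    (bm : M → M → M) (lam : M →ₗ[k] k) (D : M →ₗ[k] M) :
    M × k → M × k → M × k :=
  fun p q => (bm p.1 q.1 + q.2 • D p.1 - p.2 • D q.1, q.2 * lam p.1 - p.2 * lam q.1)

theorem stmt18 {k : Type*} [Field k] (h2 : (2 : k) ≠ 0) (h3 : (3 : k) ≠ 0) {M : Type*} [AddCommGroup M] [Module k M]
    (bm : M → M → M) (hbm : IsMalcevBracket k bm)
    (lam lam' : M →ₗ[k] k) (D D' : M →ₗ[k] M)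
    (h1 : IsMalcevBracket k (flagBr bm lam D))
    (h2' : IsMalcevBracket k (flagBr bm lam' D')) :
    (∃ φ : (M × k) →ₗ[k] (M × k), Function.Bijective φ ∧
      (∀ p q : M × k, φ (flagBr bm lam D p q) = flagBr bm lam' D' (φ p) (φ q)) ∧
      (∀ x : M, φ (x, (0 : k)) = (x, (0 : k))) ∧
      (∀ p : M × k, (φ p).2 = p.2)) ↔
    (lam = lam' ∧ ∃ m : M, ∀ x : M, D' x = bm m x + D x + lam x • m) := by
  obtain ⟨⟨hadd, hsmul, hadd', hsmul'⟩, hanti, -⟩ := hbm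
  constructor
  · rintro ⟨φ, -, hφ, hφM, hφk⟩
    set m : M := (φ (0, 1)).1
    have hφ1 : φ (0, 1) = (m, 1) := Prod.ext rfl (hφk _)
    have hφ_apply (x : M) (a : k) : φ (x, a) = (x + a • m, a) := by
      have hdecomp : ((x, a) : M × k) = (x, 0) + a • (0, 1) := by simp
      rw [hdecomp, map_add, map_smul, hφM, hφ1]
      simp
    have hbr (x : M) : D x + lam x • m = bm x m + D' x ∧ lam x = lam' x := by
      have hx0 : bm x 0 = 0 := by simpa using hsmul' 0 x 0
      have h := hφ (x, 0) (0, 1)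
      rw [hφM, hφ1] at h
      simpa [flagBr, hφ_apply, hx0] using h
    refine ⟨LinearMap.ext fun x => (hbr x).2, m, fun x => ?_⟩
    rw [hanti m x, add_assoc, (hbr x).1]
    abel
  · rintro ⟨rfl, m, hD⟩
    have hmm : bm m m = 0 := by
      have h : (2 : k) • bm m m = 0 := by
        rw [two_smul]
        nth_rewrite 1 [hanti m m]
        exact neg_add_cancel _
      exact (smul_eq_zero.mp h).resolve_left h2
    let φ : (M × k) →ₗ[k] (M × k) :=
      (LinearMap.fst k M k + (LinearMap.snd k M k).smulRight m).prod (LinearMap.snd k M k)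
    have hφ_apply (p : M × k) : φ p = (p.1 + p.2 • m, p.2) := rfl
    refine ⟨φ, ⟨fun p q h => ?_, fun p => ⟨(p.1 - p.2 • m, p.2), ?_⟩⟩,
      fun p q => ?_, fun x => ?_, fun p => rfl⟩
    · simp only [hφ_apply, Prod.mk.injEq] at h
      obtain ⟨h₁, h₂⟩ := h
      rw [h₂] at h₁
      exact Prod.ext (add_right_cancel h₁) h₂
    · simp [hφ_apply]
    · ext
      · simp only [hφ_apply, flagBr, hadd, hsmul, hadd', hsmul', hD, hmm, map_add, map_smul,
          hanti p.1 m]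
        module
      · simp only [hφ_apply, flagBr, map_add, map_smul, smul_eq_mul]
        ring
    · simp [hφ_apply]
end
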